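/- Let 1<p,q<∞ and let σ, w be Radon measures on ℝ^N. The quadratic 𝒜_{p,q}-condition is symmetric: [σ,w]_{p,q} and [w,σ]_{q′,p′} are comparable, i.e. c(p,q,N)·[w,σ]_{q′,p′} ≤ [σ,w]_{p,q} ≤ C(p,q,N)·[w,σ]_{q′,p′} with constants depending only on p, q, N (in particular one is finite iff the other is). -/

import Mathlib

open MeasureTheory ENNReal Set

noncomputable section

abbrev EucN (N : ℕ) := Fin N → ℝ

/-- The half-open cube `x + [0, 2^{-k})^N`. -/
def dyCube (N : ℕ) (k : ℤ) (x : EucN N) : Set (EucN N) :=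
  {y | ∀ i, x i ≤ y i ∧ y i < x i + (2 : ℝ) ^ (-k)}

/-- A dyadic lattice on `ℝ^N`: for every `k ∈ ℤ`, `gen k` is a partition of `ℝ^N` into
half-open cubes of side `2^{-k}`, and the generations are nested. -/
structure DyadicLattice (N : ℕ) where
  gen : ℤ → Set (Set (EucN N))
  cube_form : ∀ k Q, Q ∈ gen k → ∃ x, Q = dyCube N k x
  covers : ∀ k (y : EucN N), ∃ Q ∈ gen k, y ∈ Q
  pairwiseDisjoint : ∀ k, (gen k).PairwiseDisjoint id
  nested : ∀ k, ∀ Q ∈ gen (k + 1), ∃ R ∈ gen k, Q ⊆ R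

namespace DyadicLattice
variable {N : ℕ}
/-- The collection `𝒟` of all dyadic cubes. -/
def cubes (D : DyadicLattice N) : Set (Set (EucN N)) := ⋃ k, D.gen k
/-- `Q'` is a dyadic child of `Q`. -/
def child (D : DyadicLattice N) (Q Q' : Set (EucN N)) : Prop :=
  ∃ k, Q ∈ D.gen k ∧ Q' ∈ D.gen (k + 1) ∧ Q' ⊆ Q
/-- `R = Q^{(r)}` is the `r`-th dyadic ancestor of `Q`. -/
def anc (D : DyadicLattice N) (r : ℕ) (Q R : Set (EucN N)) : Prop :=
  ∃ k : ℤ, Q ∈ D.gen k ∧ R ∈ D.gen (k - r) ∧ Q ⊆ R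
end DyadicLattice

/-- `ℝ≥0∞`-valued indicator of a set. -/
def indE {N : ℕ} (Q : Set (EucN N)) (x : EucN N) : ℝ≥0∞ := Q.indicator 1 x

/-- `‖ (∑ i (f i)²)^{1/2} ‖_{L^p(μ)}` for a family of `ℝ≥0∞`-valued functions. -/
def sqNorm {N : ℕ} {ι : Type*} (μ : Measure (EucN N)) (p : ℝ)
    (f : ι → EucN N → ℝ≥0∞) : ℝ≥0∞ :=
  (∫⁻ x, (∑' i, f i x ^ 2) ^ (p / 2) ∂μ) ^ (1 / p)

/-- The quadratic `𝒜_{p,q}` constant `[σ,w]_{p,q}`: the least `C` such that for all real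
coefficients `(a_Q)_{Q ∈ 𝒟}`,
`‖(∑_Q (a_Q σ(Q)/|Q|)² 1_Q)^{1/2}‖_{L^q(w)} ≤ C ‖(∑_Q a_Q² 1_Q)^{1/2}‖_{L^p(σ)}`. -/
def sqA {N : ℕ} (D : DyadicLattice N) (σ w : Measure (EucN N)) (p q : ℝ) : ℝ≥0∞ :=
  sInf {C | ∀ a : Set (EucN N) → ℝ,
    sqNorm w q (fun Q : D.cubes => fun x =>
      (‖a (Q : Set (EucN N))‖₊ : ℝ≥0∞) * σ (Q : Set (EucN N)) / volume (Q : Set (EucN N))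
        * indE (Q : Set (EucN N)) x)
    ≤ C * sqNorm σ p (fun Q : D.cubes => fun x =>
      (‖a (Q : Set (EucN N))‖₊ : ℝ≥0∞) * indE (Q : Set (EucN N)) x)}

theorem rpow_sub_rpow_le_mul {r u v : ℝ} (hr : 0 < r) (hu : 0 ≤ u) (huv : u ≤ v) :
    v ^ r - u ^ r ≤ max 1 r * ((v - u) * v ^ (r - 1)) := by
  rcases hu.eq_or_lt with rfl | hu0
  · rcases huv.eq_or_lt with rfl | hv
    · simp
    · rw [Real.zero_rpow hr.ne', sub_zero, sub_zero, Real.rpow_sub_one hv.ne',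
        mul_div_cancel₀ _ hv.ne']
      exact le_mul_of_one_le_left (by positivity) (le_max_left _ _)
  have hv : 0 < v := hu0.trans_le huv
  obtain ⟨t, ht⟩ : ∃ t, t = u / v := ⟨_, rfl⟩
  have ht0 : 0 < t := ht ▸ div_pos hu0 hv
  have ht1 : t ≤ 1 := ht ▸ (div_le_one hv).2 huv
  obtain rfl : u = t * v := by rw [ht]; field_simp
  have key : 1 - t ^ r ≤ max 1 r * (1 - t) := by
    rcases le_total r 1 with h | h
    · have := Real.rpow_le_rpow_of_exponent_ge ht0 ht1 h
      rw [Real.rpow_one] at this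
      rw [max_eq_left h]; linarith
    · have := one_add_mul_self_le_rpow_one_add (s := t - 1) (by linarith) h
      rw [max_eq_right h]
      rw [add_sub_cancel] at this
      linarith
  have e : v ^ r = v * v ^ (r - 1) := by
    rw [Real.rpow_sub_one hv.ne', mul_div_cancel₀ _ hv.ne']
  have hw : 0 ≤ v * v ^ (r - 1) := by positivity
  rw [Real.mul_rpow ht0.le hv.le, e]
  nlinarith [mul_le_mul_of_nonneg_right key hw]

theorem mul_rpow_le_rpow_sub_rpow {r u v : ℝ} (hr : 0 < r) (hu : 0 ≤ u) (huv : u ≤ v) :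
    (v - u) * v ^ (r - 1) ≤ max 1 r⁻¹ * (v ^ r - u ^ r) := by
  rcases hu.eq_or_lt with rfl | hu0
  · rcases huv.eq_or_lt with rfl | hv
    · simp
    · rw [Real.zero_rpow hr.ne', sub_zero, sub_zero, Real.rpow_sub_one hv.ne',
        mul_div_cancel₀ _ hv.ne']
      exact le_mul_of_one_le_left (by positivity) (le_max_left _ _)
  have hv : 0 < v := hu0.trans_le huv
  obtain ⟨t, ht⟩ : ∃ t, t = u / v := ⟨_, rfl⟩
  have ht0 : 0 < t := ht ▸ div_pos hu0 hv
  have ht1 : t ≤ 1 := ht ▸ (div_le_one hv).2 huv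
  obtain rfl : u = t * v := by rw [ht]; field_simp
  have key : 1 - t ≤ max 1 r⁻¹ * (1 - t ^ r) := by
    rcases le_total r 1 with h | h
    · have := rpow_one_add_le_one_add_mul_self (s := t - 1) (by linarith) hr.le h
      rw [max_eq_right ((one_le_inv₀ hr).2 h), inv_mul_eq_div, le_div_iff₀ hr]
      rw [add_sub_cancel] at this
      linarith
    · have := Real.rpow_le_rpow_of_exponent_ge ht0 ht1 h
      rw [Real.rpow_one] at this
      rw [max_eq_left (inv_le_one_of_one_le₀ h)]; linarith
  have e : v ^ r = v * v ^ (r - 1) := by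
    rw [Real.rpow_sub_one hv.ne', mul_div_cancel₀ _ hv.ne']
  have hw : 0 ≤ v * v ^ (r - 1) := by positivity
  rw [Real.mul_rpow ht0.le hv.le, e]
  nlinarith [mul_le_mul_of_nonneg_right key hw]

open Classical in
theorem sum_mul_rpow_upperSum_bounds {ι : Type*} [PartialOrder ι] {r : ℝ} (hr : 0 < r)
    (x : ι → ℝ) (hx : ∀ i, 0 ≤ x i) (G : Finset ι) (hG : IsChain (· ≤ ·) (G : Set ι)) :
    (∑ i ∈ G, x i) ^ r ≤ max 1 r * ∑ i ∈ G, x i * (∑ j ∈ G with i ≤ j, x j) ^ (r - 1) ∧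
    ∑ i ∈ G, x i * (∑ j ∈ G with i ≤ j, x j) ^ (r - 1) ≤ max 1 r⁻¹ * (∑ i ∈ G, x i) ^ r := by
  induction G using Finset.strongInduction with
  | H G ih =>
  rcases G.eq_empty_or_nonempty with rfl | hne
  · simp [Real.zero_rpow hr.ne']
  obtain ⟨m, hm⟩ := G.exists_minimal hne
  have hmin : ∀ j ∈ G, m ≤ j := fun j hj =>
    (hG.total hm.1 hj).elim id (fun h => hm.2 hj h)
  obtain ⟨h1, h2⟩ := ih (G.erase m) (Finset.erase_ssubset hm.1)
    (hG.mono (by simp))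
  have e1 : ∑ i ∈ G, x i * (∑ j ∈ G with i ≤ j, x j) ^ (r - 1)
      = x m * (∑ j ∈ G, x j) ^ (r - 1)
        + ∑ i ∈ G.erase m, x i * (∑ j ∈ G.erase m with i ≤ j, x j) ^ (r - 1) := by
    rw [← Finset.add_sum_erase _ _ hm.1, Finset.filter_true_of_mem hmin]
    congr 1
    refine Finset.sum_congr rfl fun i hi => ?_
    have hi' := Finset.mem_erase.1 hi
    rw [Finset.filter_erase, Finset.erase_eq_of_notMem]
    simp only [Finset.mem_filter, not_and]
    exact fun _ h => hi'.1 (le_antisymm h (hmin i hi'.2))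
  have e2 := Finset.add_sum_erase G x hm.1
  have hu : 0 ≤ ∑ i ∈ G.erase m, x i := Finset.sum_nonneg fun i _ => hx i
  have s1 := rpow_sub_rpow_le_mul hr hu (v := ∑ i ∈ G, x i) (by linarith [hx m])
  have s2 := mul_rpow_le_rpow_sub_rpow hr hu (v := ∑ i ∈ G, x i) (by linarith [hx m])
  have e3 : ∑ i ∈ G, x i - ∑ i ∈ G.erase m, x i = x m := by linarith
  rw [e3] at s1 s2
  rw [e1]
  constructor <;> linarith

section SquareFunctions
variable {N : ℕ}

theorem dyCube_eq_pi (k : ℤ) (x : EucN N) :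
    dyCube N k x = Set.pi univ fun i => Ico (x i) (x i + (2 : ℝ) ^ (-k)) := by
  ext y; simp [dyCube]

theorem interior_dyCube_nonempty (k : ℤ) (x : EucN N) : (interior (dyCube N k x)).Nonempty := by
  rw [dyCube_eq_pi, interior_pi_set finite_univ]
  simp only [interior_Ico]
  exact univ_pi_nonempty_iff.2 fun i => nonempty_Ioo.2 (by simp; positivity)

theorem measure_dyCube_lt_top (μ : Measure (EucN N)) [IsLocallyFiniteMeasure μ] (k : ℤ)
    (x : EucN N) : μ (dyCube N k x) < ∞ := by
  refine (measure_mono ?_).trans_lt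
    (isCompact_Icc (a := x) (b := fun i => x i + (2 : ℝ) ^ (-k))).measure_lt_top
  exact fun y hy => ⟨fun i => (hy i).1, fun i => (hy i).2.le⟩

namespace DyadicLattice

theorem exists_eq_dyCube (D : DyadicLattice N) (Q : D.cubes) : ∃ k x, Q.1 = dyCube N k x := by
  obtain ⟨k, hk⟩ := mem_iUnion.1 Q.2
  exact ⟨k, D.cube_form k _ hk⟩

theorem measurableSet_cube (D : DyadicLattice N) (Q : D.cubes) : MeasurableSet Q.1 := by
  obtain ⟨k, x, h⟩ := D.exists_eq_dyCube Q
  rw [h, dyCube_eq_pi]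
  exact MeasurableSet.univ_pi fun _ => measurableSet_Ico

theorem measure_cube_ne_top (D : DyadicLattice N) (μ : Measure (EucN N))
    [IsLocallyFiniteMeasure μ] (Q : D.cubes) : μ Q.1 ≠ ∞ := by
  obtain ⟨k, x, h⟩ := D.exists_eq_dyCube Q
  exact h ▸ (measure_dyCube_lt_top μ k x).ne

theorem volume_cube_ne_zero (D : DyadicLattice N) (Q : D.cubes) : volume Q.1 ≠ 0 := by
  obtain ⟨k, x, h⟩ := D.exists_eq_dyCube Q
  exact h ▸ (Measure.measure_pos_of_nonempty_interior _ (interior_dyCube_nonempty k x)).ne'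

theorem countable_cubes (D : DyadicLattice N) : Countable D.cubes := by
  refine (countable_iUnion fun k => ?_).to_subtype
  refine (D.pairwiseDisjoint k).countable_of_nonempty_interior fun Q hQ => ?_
  obtain ⟨x, rfl⟩ := D.cube_form k Q hQ
  exact interior_dyCube_nonempty k x

theorem exists_superset_of_mem_gen_add (D : DyadicLattice N) (k : ℤ) (n : ℕ) :
    ∀ Q ∈ D.gen (k + n), ∃ R ∈ D.gen k, Q ⊆ R := by
  induction n with
  | zero => intro Q hQ; exact ⟨Q, by simpa using hQ, subset_rfl⟩
  | succ n ih =>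
    intro Q hQ
    obtain ⟨R, hR, hQR⟩ := D.nested (k + n) Q (by push_cast at hQ; rwa [add_assoc])
    obtain ⟨P, hP, hRP⟩ := ih R hR
    exact ⟨P, hP, hQR.trans hRP⟩

theorem subset_of_mem_of_le (D : DyadicLattice N) {k l : ℤ} (hkl : k ≤ l)
    {Q R : Set (EucN N)} (hQ : Q ∈ D.gen k) (hR : R ∈ D.gen l) {x : EucN N} (hxQ : x ∈ Q)
    (hxR : x ∈ R) : R ⊆ Q := by
  obtain ⟨n, rfl⟩ := Int.le.dest hkl
  obtain ⟨P, hP, hRP⟩ := D.exists_superset_of_mem_gen_add k n R hR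
  obtain rfl : P = Q := by
    by_contra hne
    exact disjoint_left.1 (D.pairwiseDisjoint k hP hQ hne) (hRP hxR) hxQ
  exact hRP

theorem isChain_cubes_mem (D : DyadicLattice N) (x : EucN N) :
    IsChain (· ≤ ·) {Q : D.cubes | x ∈ Q.1} := by
  intro Q hQ R hR _
  obtain ⟨k, hk⟩ := mem_iUnion.1 Q.2
  obtain ⟨l, hl⟩ := mem_iUnion.1 R.2
  rcases le_total k l with h | h
  · exact Or.inr (D.subset_of_mem_of_le h hk hl hQ hR)
  · exact Or.inl (D.subset_of_mem_of_le h hl hk hR hQ)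

end DyadicLattice

variable {D : DyadicLattice N}

theorem measurable_mul_indE (c : ℝ≥0∞) (Q : D.cubes) :
    Measurable fun x => c * indE (Q : Set (EucN N)) x :=
  (measurable_one.indicator (D.measurableSet_cube Q)).const_mul c

theorem measurable_tsum_sq_mul_indE (c : D.cubes → ℝ≥0∞) :
    Measurable fun x => ∑' Q : D.cubes, (c Q * indE (Q : Set (EucN N)) x) ^ 2 := by
  have := D.countable_cubes
  exact Measurable.tsum fun Q => (measurable_mul_indE _ Q).pow_const 2

open Classical in
theorem tsum_sq_mul_indE_eq_sum {F : Finset D.cubes} {c : D.cubes → NNReal}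
    (hc : ∀ Q ∉ F, c Q = 0) (x : EucN N) :
    ∑' Q : D.cubes, ((c Q : ℝ≥0∞) * indE (Q : Set (EucN N)) x) ^ 2
      = ((∑ Q ∈ F with x ∈ Q.1, c Q ^ 2 : NNReal) : ℝ≥0∞) := by
  rw [tsum_eq_sum (s := F) fun Q hQ => by simp [hc Q hQ], Finset.sum_filter]
  push_cast
  refine Finset.sum_congr rfl fun Q _ => ?_
  by_cases h : x ∈ (Q : Set (EucN N)) <;> simp [indE, h]

theorem lintegral_sum_mul_le_sqNorm_mul_sqNorm {p p' : ℝ} (hpp : p.HolderConjugate p')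
    (μ : Measure (EucN N)) (f g : D.cubes → ℝ≥0∞) (F : Finset D.cubes) :
    ∑ Q ∈ F, f Q * g Q * μ (Q : Set (EucN N)) ≤
      sqNorm μ p (fun Q : D.cubes => fun x => f Q * indE (Q : Set (EucN N)) x) *
      sqNorm μ p' (fun Q : D.cubes => fun x => g Q * indE (Q : Set (EucN N)) x) := by
  have e : ∀ (r : ℝ) (y : ℝ≥0∞), y ^ (r / 2) = (y ^ (1 / 2 : ℝ)) ^ r := fun r y => by
    rw [← ENNReal.rpow_mul]; congr 1; ring
  have key := ENNReal.lintegral_mul_le_Lp_mul_Lq μ hpp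
    ((measurable_tsum_sq_mul_indE f).pow_const (1 / 2 : ℝ)).aemeasurable
    ((measurable_tsum_sq_mul_indE g).pow_const (1 / 2 : ℝ)).aemeasurable
  simp only [← e] at key
  refine le_trans ?_ key
  calc ∑ Q ∈ F, f Q * g Q * μ (Q : Set (EucN N))
      = ∫⁻ x, ∑ Q ∈ F, (f Q * indE (Q : Set (EucN N)) x) * (g Q * indE (Q : Set (EucN N)) x) ∂μ := by
        rw [lintegral_finsetSum _ fun Q _ => by
          exact Measurable.mul (measurable_mul_indE _ Q) (measurable_mul_indE _ Q)]
        refine Finset.sum_congr rfl fun Q _ => ?_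
        rw [← lintegral_indicator_const (D.measurableSet_cube Q)]
        refine lintegral_congr fun x => ?_
        by_cases h : x ∈ (Q : Set (EucN N)) <;> simp [indE, h]
    _ ≤ _ := by
        refine lintegral_mono fun x => ?_
        have h := ENNReal.inner_le_Lp_mul_Lq F (fun Q => f Q * indE (Q : Set (EucN N)) x)
          (fun Q => g Q * indE (Q : Set (EucN N)) x) Real.HolderConjugate.two_two
        simp only [ENNReal.rpow_two] at h
        refine h.trans (mul_le_mul' ?_ ?_) <;>
        exact ENNReal.rpow_le_rpow (ENNReal.sum_le_tsum _) (by norm_num)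

open Classical in
/-- The sum of the squared coefficients over the cubes of `F` containing `Q`. -/
def ancestorSum (F : Finset D.cubes) (b : D.cubes → NNReal) (Q : D.cubes) : NNReal :=
  ∑ R ∈ F with Q ≤ R, b R ^ 2

open Classical in
theorem sum_sq_mul_ancestorSum_rpow_bounds {r : ℝ} (hr : 0 < r) (F : Finset D.cubes)
    (b : D.cubes → NNReal) (x : EucN N) :
    (∑ Q ∈ F with x ∈ Q.1, b Q ^ 2) ^ r ≤ (max 1 r).toNNReal *
      ∑ Q ∈ F with x ∈ Q.1, b Q ^ 2 * ancestorSum F b Q ^ (r - 1) ∧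
    ∑ Q ∈ F with x ∈ Q.1, b Q ^ 2 * ancestorSum F b Q ^ (r - 1) ≤
      (max 1 r⁻¹).toNNReal * (∑ Q ∈ F with x ∈ Q.1, b Q ^ 2) ^ r := by
  have h := sum_mul_rpow_upperSum_bounds hr (fun Q : D.cubes => (b Q : ℝ) ^ 2)
    (fun Q => by positivity) (F.filter fun Q => x ∈ Q.1)
    ((D.isChain_cubes_mem x).mono fun Q hQ => (Finset.mem_filter.1 hQ).2)
  have e : ∑ Q ∈ F with x ∈ Q.1, (b Q : ℝ) ^ 2 *
        (∑ R ∈ F.filter (fun Q => x ∈ Q.1) with Q ≤ R, (b R : ℝ) ^ 2) ^ (r - 1)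
      = ∑ Q ∈ F with x ∈ Q.1,
        (b Q : ℝ) ^ 2 * (ancestorSum F b Q : ℝ) ^ (r - 1) := by
    refine Finset.sum_congr rfl fun Q hQ => ?_
    rw [ancestorSum, Finset.filter_filter, NNReal.coe_sum]
    simp only [NNReal.coe_pow]
    have hx := (Finset.mem_filter.1 hQ).2
    congr 2
    refine Finset.sum_congr (Finset.filter_congr fun R _ => ?_) fun _ _ => rfl
    exact ⟨fun h => h.2, fun h => ⟨h hx, h⟩⟩
  rw [e] at h
  have m1 : (0 : ℝ) ≤ max 1 r := by positivity
  have m2 : (0 : ℝ) ≤ max 1 r⁻¹ := by positivity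
  simp only [← NNReal.coe_le_coe, NNReal.coe_mul, NNReal.coe_rpow, NNReal.coe_sum, NNReal.coe_pow,
    Real.coe_toNNReal _ m1, Real.coe_toNNReal _ m2]
  exact h

/-- The coefficients `b_Q S_Q^{q-2}`, with `S_Q² = ∑_{R ⊇ Q} b_R²`, which norm the square
function with coefficients `b` in `L^q`. -/
def dualCoeff (q : ℝ) (F : Finset D.cubes) (b : D.cubes → NNReal) (Q : D.cubes) : NNReal :=
  b Q * ancestorSum F b Q ^ (q / 2 - 1)

theorem lintegral_sq_rpow_le_sum_dualCoeff {q : ℝ} (hq : 0 < q) {F : Finset D.cubes}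
    {b : D.cubes → NNReal} (hb : ∀ Q ∉ F, b Q = 0) (w : Measure (EucN N)) :
    ∫⁻ x, (∑' Q : D.cubes, ((b Q : ℝ≥0∞) * indE (Q : Set (EucN N)) x) ^ 2) ^ (q / 2) ∂w ≤
      ENNReal.ofReal (max 1 (q / 2)) *
        ∑ Q ∈ F, (b Q : ℝ≥0∞) * dualCoeff q F b Q * w (Q : Set (EucN N)) := by
  classical
  calc _ ≤ ∫⁻ x, ENNReal.ofReal (max 1 (q / 2)) * ∑ Q ∈ F,
        ((b Q : ℝ≥0∞) * dualCoeff q F b Q) * indE (Q : Set (EucN N)) x ∂w := by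
        refine lintegral_mono fun x => ?_
        have h := (sum_sq_mul_ancestorSum_rpow_bounds (half_pos hq) F b x).1
        rw [tsum_sq_mul_indE_eq_sum hb, ← ENNReal.coe_rpow_of_nonneg _ (half_pos hq).le]
        refine (ENNReal.coe_le_coe.2 h).trans_eq ?_
        rw [ENNReal.coe_mul, ENNReal.ofReal, Finset.sum_filter]
        push_cast
        congr 1
        refine Finset.sum_congr rfl fun Q _ => ?_
        by_cases hx : x ∈ (Q : Set (EucN N))
        · simp only [hx, if_true, indE, indicator_of_mem, Pi.one_apply, mul_one]
          rw [← ENNReal.coe_mul, dualCoeff, ← mul_assoc, ← sq]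
        · simp [hx, indE]
    _ = _ := by
        rw [lintegral_const_mul _ (Finset.measurable_sum _ fun Q _ => measurable_mul_indE _ Q),
          lintegral_finsetSum _ fun Q _ => measurable_mul_indE _ Q]
        congr 1
        refine Finset.sum_congr rfl fun Q _ => ?_
        rw [← lintegral_indicator_const (D.measurableSet_cube Q)]
        refine lintegral_congr fun x => ?_
        by_cases h : x ∈ (Q : Set (EucN N)) <;> simp [indE, h]

theorem sqNorm_dualCoeff_le {q q' : ℝ} (hq : q.HolderConjugate q') {F : Finset D.cubes}
    {b : D.cubes → NNReal} (hb : ∀ Q ∉ F, b Q = 0) (w : Measure (EucN N)) :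
    sqNorm w q' (fun Q : D.cubes => fun x =>
        (dualCoeff q F b Q : ℝ≥0∞) * indE (Q : Set (EucN N)) x) ≤
      ENNReal.ofReal (max 1 (q - 1)⁻¹) ^ (1 / 2 : ℝ) *
      (∫⁻ x, (∑' Q : D.cubes, ((b Q : ℝ≥0∞) * indE (Q : Set (EucN N)) x) ^ 2) ^ (q / 2) ∂w)
        ^ (1 / q') := by
  classical
  have hq0 := hq.pos
  have hq1 : 0 < q - 1 := hq.sub_one_pos
  have hq'0 := hq.symm.pos
  have hd : ∀ Q ∉ F, dualCoeff q F b Q = 0 := fun Q hQ => by simp [dualCoeff, hb Q hQ]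
  have hpt : ∀ x, (∑' Q : D.cubes,
        ((dualCoeff q F b Q : ℝ≥0∞) * indE (Q : Set (EucN N)) x) ^ 2) ^ (q' / 2) ≤
      ENNReal.ofReal (max 1 (q - 1)⁻¹) ^ (q' / 2) *
      (∑' Q : D.cubes, ((b Q : ℝ≥0∞) * indE (Q : Set (EucN N)) x) ^ 2) ^ (q / 2) := fun x => by
    have h := (sum_sq_mul_ancestorSum_rpow_bounds hq1 F b x).2
    have e : (q / 2 : ℝ) = (q - 1) * (q' / 2) := by
      have := hq.sub_one_mul_conj
      linarith
    rw [tsum_sq_mul_indE_eq_sum hb, tsum_sq_mul_indE_eq_sum hd, e, ENNReal.rpow_mul,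
      ← ENNReal.mul_rpow_of_nonneg _ _ (half_pos hq'0).le,
      ← ENNReal.coe_rpow_of_nonneg _ hq1.le, ENNReal.ofReal, ← ENNReal.coe_mul]
    refine ENNReal.rpow_le_rpow (ENNReal.coe_le_coe.2 (le_trans (le_of_eq ?_) h))
      (half_pos hq'0).le
    refine Finset.sum_congr rfl fun Q _ => ?_
    rw [dualCoeff, mul_pow, ← NNReal.rpow_natCast (_ ^ (_ : ℝ)), ← NNReal.rpow_mul]
    congr 2
    push_cast; ring
  calc _ ≤ (∫⁻ x, ENNReal.ofReal (max 1 (q - 1)⁻¹) ^ (q' / 2) *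
      (∑' Q : D.cubes, ((b Q : ℝ≥0∞) * indE (Q : Set (EucN N)) x) ^ 2) ^ (q / 2) ∂w)
        ^ (1 / q') :=
        ENNReal.rpow_le_rpow (lintegral_mono hpt) (by positivity)
    _ = _ := by
        rw [lintegral_const_mul _ ((measurable_tsum_sq_mul_indE _).pow_const _),
          ENNReal.mul_rpow_of_nonneg _ _ (by positivity), ← ENNReal.rpow_mul]
        congr 2
        field_simp

theorem lintegral_sq_rpow_ne_top {q : ℝ} (hq : 1 < q) {F : Finset D.cubes}
    {b : D.cubes → NNReal} (hb : ∀ Q ∉ F, b Q = 0) (w : Measure (EucN N))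
    [IsLocallyFiniteMeasure w] :
    ∫⁻ x, (∑' Q : D.cubes, ((b Q : ℝ≥0∞) * indE (Q : Set (EucN N)) x) ^ 2) ^ (q / 2) ∂w ≠ ∞ :=
  ne_top_of_le_ne_top
    (ENNReal.mul_ne_top ENNReal.ofReal_ne_top (ENNReal.sum_ne_top.2 fun Q _ =>
      ENNReal.mul_ne_top (ENNReal.mul_ne_top coe_ne_top coe_ne_top) (D.measure_cube_ne_top w Q)))
    (lintegral_sq_rpow_le_sum_dualCoeff (by linarith) hb w)

/-- The constant in the comparison of `[σ,w]_{p,q}` with `[w,σ]_{q',p'}`. -/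
def sqDualConst (q : ℝ) : ℝ≥0∞ :=
  ENNReal.ofReal (max 1 (q / 2)) * ENNReal.ofReal (max 1 (q - 1)⁻¹) ^ (1 / 2 : ℝ)

theorem sqDualConst_ne_top (q : ℝ) : sqDualConst q ≠ ∞ :=
  ENNReal.mul_ne_top ENNReal.ofReal_ne_top
    (ENNReal.rpow_ne_top_of_nonneg (by norm_num) ENNReal.ofReal_ne_top)

theorem sqDualConst_ne_zero (q : ℝ) : sqDualConst q ≠ 0 := by
  have h : ∀ y : ℝ, ENNReal.ofReal (max 1 y) ≠ 0 := fun y => by simp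
  exact mul_ne_zero (h _) fun h0 => h _ ((ENNReal.rpow_eq_zero_iff_of_pos (by norm_num)).1 h0)

theorem sqNorm_le_of_dual_of_finite {p p' q q' : ℝ} (hp : p.HolderConjugate p')
    (hq : q.HolderConjugate q') (σ w : Measure (EucN N)) [IsLocallyFiniteMeasure σ]
    [IsLocallyFiniteMeasure w] {K : ℝ≥0∞}
    (hK : ∀ β : D.cubes → NNReal,
      sqNorm σ p' (fun Q : D.cubes => fun x =>
        (β Q : ℝ≥0∞) * w (Q : Set (EucN N)) / volume (Q : Set (EucN N))
          * indE (Q : Set (EucN N)) x) ≤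
      K * sqNorm w q' (fun Q : D.cubes => fun x => (β Q : ℝ≥0∞) * indE (Q : Set (EucN N)) x))
    {F : Finset D.cubes} {α : D.cubes → NNReal} (hα : ∀ Q ∉ F, α Q = 0) :
    sqNorm w q (fun Q : D.cubes => fun x =>
        (α Q : ℝ≥0∞) * σ (Q : Set (EucN N)) / volume (Q : Set (EucN N))
          * indE (Q : Set (EucN N)) x) ≤
      sqDualConst q * K *
        sqNorm σ p (fun Q : D.cubes => fun x => (α Q : ℝ≥0∞) * indE (Q : Set (EucN N)) x) := by
  have hb' : ∀ Q : D.cubes,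
      (α Q : ℝ≥0∞) * σ (Q : Set (EucN N)) / volume (Q : Set (EucN N)) ≠ ∞ := fun Q =>
    ENNReal.div_ne_top (ENNReal.mul_ne_top coe_ne_top (D.measure_cube_ne_top σ Q))
      (D.volume_cube_ne_zero Q)
  obtain ⟨b, hb⟩ : ∃ b : D.cubes → NNReal, ∀ Q : D.cubes,
      (α Q : ℝ≥0∞) * σ (Q : Set (EucN N)) / volume (Q : Set (EucN N)) = b Q :=
    ⟨fun Q => ENNReal.toNNReal _, fun Q => (ENNReal.coe_toNNReal (hb' Q)).symm⟩
  have hbF : ∀ Q ∉ F, b Q = 0 := fun Q hQ => by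
    have := hb Q
    simpa [hα Q hQ] using this.symm
  simp only [hb]
  set X := ∫⁻ x, (∑' Q : D.cubes, ((b Q : ℝ≥0∞) * indE (Q : Set (EucN N)) x) ^ 2) ^ (q / 2) ∂w
    with hX
  set A := sqNorm σ p (fun Q : D.cubes => fun x => (α Q : ℝ≥0∞) * indE (Q : Set (EucN N)) x)
  have hXtop : X ≠ ∞ := lintegral_sq_rpow_ne_top hq.lt hbF w
  have hmain : X ≤ sqDualConst q * K * A * X ^ (1 / q') := by
    calc X ≤ ENNReal.ofReal (max 1 (q / 2)) *
        ∑ Q ∈ F, (b Q : ℝ≥0∞) * dualCoeff q F b Q * w (Q : Set (EucN N)) :=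
          lintegral_sq_rpow_le_sum_dualCoeff hq.pos hbF w
      _ = ENNReal.ofReal (max 1 (q / 2)) * ∑ Q ∈ F, (α Q : ℝ≥0∞) *
          (dualCoeff q F b Q * w (Q : Set (EucN N)) / volume (Q : Set (EucN N)))
            * σ (Q : Set (EucN N)) := by
          congr 1
          refine Finset.sum_congr rfl fun Q _ => ?_
          rw [← hb]
          simp only [div_eq_mul_inv]
          ring
      _ ≤ ENNReal.ofReal (max 1 (q / 2)) * (A * (K *
          (ENNReal.ofReal (max 1 (q - 1)⁻¹) ^ (1 / 2 : ℝ) * X ^ (1 / q')))) := by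
          gcongr
          refine (lintegral_sum_mul_le_sqNorm_mul_sqNorm hp σ _ _ F).trans ?_
          gcongr
          refine (hK _).trans ?_
          gcongr
          exact sqNorm_dualCoeff_le hq hbF w
      _ = _ := by rw [sqDualConst]; ring
  change X ^ (1 / q) ≤ _
  rcases eq_or_ne X 0 with h0 | h0
  · rw [h0, ENNReal.zero_rpow_of_pos (one_div_pos.2 hq.pos)]
    exact zero_le
  have hpos : X ^ (1 / q') ≠ 0 := by
    simp [ENNReal.rpow_eq_zero_iff, h0, hXtop]
  have hfin : X ^ (1 / q') ≠ ∞ :=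
    ENNReal.rpow_ne_top_of_nonneg (one_div_pos.2 hq.symm.pos).le hXtop
  refine (ENNReal.mul_le_mul_iff_left hpos hfin).1 (le_trans (le_of_eq ?_) hmain)
  rw [← ENNReal.rpow_add _ _ h0 hXtop, one_div, one_div, hq.inv_add_inv_eq_one, ENNReal.rpow_one]

open Classical in
theorem sqNorm_le_of_forall_finset {q : ℝ} (hq : 0 < q) (w : Measure (EucN N))
    (c : D.cubes → ℝ≥0∞) {B : ℝ≥0∞}
    (h : ∀ F : Finset D.cubes, sqNorm w q (fun Q : D.cubes => fun x =>
      (if Q ∈ F then c Q else 0) * indE (Q : Set (EucN N)) x) ≤ B) :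
    sqNorm w q (fun Q : D.cubes => fun x => c Q * indE (Q : Set (EucN N)) x) ≤ B := by
  have := D.countable_cubes
  have hq2 := half_pos hq
  have hF : ∀ (F : Finset D.cubes) x,
      ∑' Q : D.cubes, ((if Q ∈ F then c Q else 0) * indE (Q : Set (EucN N)) x) ^ 2
        = ∑ Q ∈ F, (c Q * indE (Q : Set (EucN N)) x) ^ 2 := fun F x => by
    rw [tsum_eq_sum (s := F) fun Q hQ => by simp [hQ]]
    exact Finset.sum_congr rfl fun Q hQ => by simp [hQ]
  simp only [sqNorm, hF, one_div, ENNReal.rpow_inv_le_iff hq] at h ⊢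
  have hsup : ∀ x, (∑' Q : D.cubes, (c Q * indE (Q : Set (EucN N)) x) ^ 2) ^ (q / 2)
      = ⨆ F : Finset D.cubes, (∑ Q ∈ F, (c Q * indE (Q : Set (EucN N)) x) ^ 2) ^ (q / 2) :=
    fun x => by
      rw [ENNReal.tsum_eq_iSup_sum]
      exact (ENNReal.orderIsoRpow (q / 2) hq2).map_iSup _
  simp only [hsup]
  rw [lintegral_iSup_directed]
  · exact iSup_le h
  · exact fun F => ((Finset.measurable_sum _ fun Q _ =>
      (measurable_mul_indE _ Q).pow_const 2).pow_const _).aemeasurable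
  · exact Monotone.directed_le fun F G hFG x =>
      ENNReal.rpow_le_rpow (Finset.sum_le_sum_of_subset hFG) hq2.le

theorem sqA_le_sqDualConst_mul {p p' q q' : ℝ} (hp : p.HolderConjugate p')
    (hq : q.HolderConjugate q') (D : DyadicLattice N) (σ w : Measure (EucN N))
    [IsLocallyFiniteMeasure σ] [IsLocallyFiniteMeasure w] :
    sqA D σ w p q ≤ sqDualConst q * sqA D w σ q' p' := by
  classical
  rw [mul_comm, ← ENNReal.div_le_iff_le_mul (Or.inl (sqDualConst_ne_zero q))
    (Or.inl (sqDualConst_ne_top q))]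
  refine le_sInf fun K hK => ?_
  rw [ENNReal.div_le_iff_le_mul (Or.inl (sqDualConst_ne_zero q))
    (Or.inl (sqDualConst_ne_top q)), mul_comm]
  refine sInf_le fun a => ?_
  have hK' : ∀ β : D.cubes → NNReal, _ := fun β => by
    have := hK fun Q => if h : Q ∈ D.cubes then (β ⟨Q, h⟩ : ℝ) else 0
    simpa using this
  refine sqNorm_le_of_forall_finset hq.pos w _ fun F => ?_
  have h := sqNorm_le_of_dual_of_finite hp hq σ w hK' (F := F)
    (α := fun Q => if Q ∈ F then ‖a Q‖₊ else 0) (fun Q hQ => if_neg hQ)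
  refine le_trans (le_of_eq ?_) (h.trans ?_)
  · congr 1
    funext Q x
    split_ifs <;> simp
  · gcongr
    refine ENNReal.rpow_le_rpow (lintegral_mono fun x => ENNReal.rpow_le_rpow
      (ENNReal.tsum_le_tsum fun Q => ?_) (half_pos hp.pos).le) (one_div_pos.2 hp.pos).le
    dsimp only
    gcongr
    split_ifs <;> simp

end SquareFunctions

/-- The quadratic `𝒜_{p,q}`-condition is symmetric: `[σ,w]_{p,q}` and
`[w,σ]_{q',p'}` are comparable, with constants depending only on `p`, `q`, `N`. -/
theorem quadratic_Apq_symmetric (p q : ℝ) (N : ℕ) (hp : 1 < p) (hq : 1 < q) (hN : 1 ≤ N) :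
    ∃ c C : ℝ≥0∞, 0 < c ∧ C ≠ ∞ ∧
      ∀ (D : DyadicLattice N) (σ w : Measure (EucN N)),
        IsLocallyFiniteMeasure σ → IsLocallyFiniteMeasure w →
        c * sqA D w σ (q / (q - 1)) (p / (p - 1)) ≤ sqA D σ w p q ∧
        sqA D σ w p q ≤ C * sqA D w σ (q / (q - 1)) (p / (p - 1)) := by
  have hp' : p.HolderConjugate (p / (p - 1)) := Real.HolderConjugate.conjExponent hp
  have hq' : q.HolderConjugate (q / (q - 1)) := Real.HolderConjugate.conjExponent hq
  refine ⟨(sqDualConst (p / (p - 1)))⁻¹, sqDualConst q,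
    ENNReal.inv_pos.2 (sqDualConst_ne_top _), sqDualConst_ne_top q, fun D σ w hσ hw => ⟨?_, ?_⟩⟩
  · rw [ENNReal.inv_mul_le_iff (sqDualConst_ne_zero _) (sqDualConst_ne_top _)]
    exact sqA_le_sqDualConst_mul hq'.symm hp'.symm D w σ
  · exact sqA_le_sqDualConst_mul hp' hq' D σ w

end
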